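/- Let ⟨1, c₂, c₃, c₄, c₅⟩ be a coin system with five types of coins. The subsystem ⟨1, c₂, c₃, c₄⟩ is non-canonical while the full system ⟨1, c₂, c₃, c₄, c₅⟩ is canonical if and only if c₃ > 3, c₂ = 2, c₄ = c₃ + 1, and c₅ = 2·c₃. -/

import Mathlib

/-- A coin system `⟨c 1, c 2, …, c m⟩` is a strictly increasing finite sequence of
positive integers with `c 1 = 1` (only the values `c i` for `1 ≤ i ≤ m` matter). -/
def IsCoinSystem (m : ℕ) (c : ℕ → ℕ) : Prop :=
  c 1 = 1 ∧ ∀ i j, 1 ≤ i → i < j → j ≤ m → c i < c j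

/-- `α` is a representation of `x` under the coin system `⟨c 1, …, c m⟩`. -/
def IsRepr (m : ℕ) (c : ℕ → ℕ) (x : ℕ) (α : ℕ → ℕ) : Prop :=
  ∑ i ∈ Finset.Icc 1 m, α i * c i = x

/-- The size of a representation, i.e. the total number of coins used. -/
def reprSize (m : ℕ) (α : ℕ → ℕ) : ℕ :=
  ∑ i ∈ Finset.Icc 1 m, α i

/-- `α` is the greedy representation of `x`: a representation such that for every
`2 ≤ i ≤ m` the part of the sum using coins smaller than `c i` is `< c i`. -/
def IsGreedy (m : ℕ) (c : ℕ → ℕ) (x : ℕ) (α : ℕ → ℕ) : Prop :=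
  IsRepr m c x α ∧
    ∀ i, 2 ≤ i → i ≤ m → ∑ j ∈ Finset.Icc 1 (i - 1), α j * c j < c i

/-- `α` is an optimal (minimum-size) representation of `x`. -/
def IsOpt (m : ℕ) (c : ℕ → ℕ) (x : ℕ) (α : ℕ → ℕ) : Prop :=
  IsRepr m c x α ∧ ∀ β, IsRepr m c x β → reprSize m α ≤ reprSize m β

/-- `x` is a counterexample: the greedy representation of `x` is strictly larger
than some representation of `x` (equivalently, than an optimal one). -/
def IsCounterexample (m : ℕ) (c : ℕ → ℕ) (x : ℕ) : Prop :=
  ∃ γ β, IsGreedy m c x γ ∧ IsRepr m c x β ∧ reprSize m β < reprSize m γ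

/-- A coin system is non-canonical if it has a counterexample. -/
def NonCanonical (m : ℕ) (c : ℕ → ℕ) : Prop :=
  ∃ x, IsCounterexample m c x

/-- A coin system is canonical if `|GRD(x)| = |OPT(x)|` for all `x`,
i.e. it has no counterexample. -/
def IsCanonical (m : ℕ) (c : ℕ → ℕ) : Prop :=
  ∀ x, ¬ IsCounterexample m c x

/-- A coin system is tight if it has no counterexample smaller than its largest coin. -/
def Tight (m : ℕ) (c : ℕ → ℕ) : Prop :=
  ∀ x, x < c m → ¬ IsCounterexample m c x

/-- `x` is the smallest counterexample of the coin system. -/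
def SmallestCounterexample (m : ℕ) (c : ℕ → ℕ) (x : ℕ) : Prop :=
  IsCounterexample m c x ∧ ∀ y, y < x → ¬ IsCounterexample m c y

/-- The number of coins used by the greedy algorithm on `x` with the coins `c 1, …, c m`. -/
def greedySize (c : ℕ → ℕ) : ℕ → ℕ → ℕ
  | 0, _ => 0
  | m + 1, x => x / c (m + 1) + greedySize c m (x % c (m + 1))

/-- Subadditivity of a function on the natural numbers. -/
def IsSubadditive (f : ℕ → ℕ) : Prop := ∀ x y, f (x + y) ≤ f x + f y

theorem IsCoinSystem.mono {m n : ℕ} {c : ℕ → ℕ} (hc : IsCoinSystem m c) (h : n ≤ m) :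
    IsCoinSystem n c :=
  ⟨hc.1, fun i j hi hij hj => hc.2 i j hi hij (hj.trans h)⟩

theorem IsCoinSystem.pos {m : ℕ} {c : ℕ → ℕ} (hc : IsCoinSystem m c) {i : ℕ} (hi : 1 ≤ i)
    (him : i ≤ m) : 0 < c i := by
  rcases hi.eq_or_lt with rfl | h
  · rw [hc.1]; exact one_pos
  · exact (Nat.zero_le _).trans_lt (hc.2 1 i le_rfl h him)

theorem greedySize_zero (c : ℕ → ℕ) (m : ℕ) : greedySize c m 0 = 0 := by
  induction m with
  | zero => rfl
  | succ m ih => simp [greedySize, ih]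

theorem greedySize_succ_of_lt {c : ℕ → ℕ} {m x : ℕ} (h : x < c (m + 1)) :
    greedySize c (m + 1) x = greedySize c m x := by
  simp [greedySize, Nat.div_eq_of_lt h, Nat.mod_eq_of_lt h]

theorem greedySize_succ_add {c : ℕ → ℕ} {m : ℕ} (hpos : 0 < c (m + 1)) (x : ℕ) :
    greedySize c (m + 1) (c (m + 1) + x) = 1 + greedySize c (m + 1) x := by
  simp only [greedySize, Nat.add_mod_left, Nat.add_div_left x hpos]
  omega

theorem greedySize_succ_mul_add {c : ℕ → ℕ} {m : ℕ} (hpos : 0 < c (m + 1)) (k x : ℕ) :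
    greedySize c (m + 1) (k * c (m + 1) + x) = k + greedySize c (m + 1) x := by
  induction k with
  | zero => simp
  | succ k ih =>
    rw [show (k + 1) * c (m + 1) + x = c (m + 1) + (k * c (m + 1) + x) by ring,
      greedySize_succ_add hpos, ih]
    ring

theorem greedySize_coin_le {c : ℕ → ℕ} {m : ℕ} (hc : IsCoinSystem m c) {i : ℕ} (hi : 1 ≤ i)
    (him : i ≤ m) : greedySize c m (c i) ≤ 1 := by
  induction m with
  | zero => omega
  | succ m ih =>
    rcases him.eq_or_lt with rfl | h
    · have := greedySize_succ_add (hc.pos hi le_rfl) 0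
      rw [greedySize_zero] at this
      exact this.le
    · rw [greedySize_succ_of_lt (hc.2 i (m + 1) hi h le_rfl)]
      exact ih (hc.mono m.le_succ) (by omega)

theorem eq_zero_or_coin_of_greedySize_le_one {c : ℕ → ℕ} {m : ℕ} (hc : IsCoinSystem m c)
    (hm : 1 ≤ m) {x : ℕ} (h : greedySize c m x ≤ 1) :
    x = 0 ∨ ∃ i, 1 ≤ i ∧ i ≤ m ∧ x = c i := by
  induction m, hm using Nat.le_induction generalizing x with
  | base =>
    simp only [greedySize, zero_add, hc.1, Nat.div_one] at h
    by_cases hx : x = 0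
    · exact Or.inl hx
    · exact Or.inr ⟨1, le_rfl, le_rfl, by rw [hc.1]; omega⟩
  | succ m hm ih =>
    have hpos := hc.pos (i := m + 1) (by omega) le_rfl
    by_cases hx : x < c (m + 1)
    · rw [greedySize_succ_of_lt hx] at h
      rcases ih (hc.mono m.le_succ) h with h | ⟨i, h1, h2, h3⟩
      · exact Or.inl h
      · exact Or.inr ⟨i, h1, by omega, h3⟩
    · obtain ⟨y, rfl⟩ := Nat.exists_eq_add_of_le (not_lt.mp hx)
      rw [greedySize_succ_add hpos] at h
      have h0 : greedySize c (m + 1) y = 0 := by omega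
      have hy : y < c (m + 1) := by
        by_contra hy
        obtain ⟨z, rfl⟩ := Nat.exists_eq_add_of_le (not_lt.mp hy)
        rw [greedySize_succ_add hpos] at h0
        omega
      have h1 := h0
      rw [greedySize_succ_of_lt hy] at h1
      rcases ih (hc.mono m.le_succ) (x := y) (by omega) with h | ⟨i, hi, him, rfl⟩
      · exact Or.inr ⟨m + 1, by omega, le_rfl, by omega⟩
      · exfalso
        have : ∀ n, i ≤ n → greedySize c n (c i) = 0 → i ≤ n → n ≤ m + 1 → False := by
          intro n hn
          induction n, hn using Nat.le_induction with
          | base =>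
            intro h _ _
            obtain ⟨j, rfl⟩ : ∃ j, i = j + 1 := ⟨i - 1, by omega⟩
            have := greedySize_succ_add (c := c) (m := j)
              (hc.pos (i := j + 1) (by omega) (by omega)) 0
            simp only [add_zero] at this
            omega
          | succ n hn ihn =>
            intro h _ hnm
            rw [greedySize_succ_of_lt (hc.2 i (n + 1) hi (by omega) hnm)] at h
            exact ihn h hn (by omega)
        exact this m him h1 him (by omega)

theorem IsGreedy.reprSize_eq {c : ℕ → ℕ} {m x : ℕ} {γ : ℕ → ℕ} (hc : IsCoinSystem m c)
    (h : IsGreedy m c x γ) : reprSize m γ = greedySize c m x := by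
  induction m generalizing x with
  | zero => simp [reprSize, greedySize]
  | succ m ih =>
    have hpos := hc.pos (i := m + 1) (by omega) le_rfl
    obtain ⟨hr, hlt⟩ := h
    have hS : ∑ j ∈ Finset.Icc 1 m, γ j * c j < c (m + 1) := by
      rcases Nat.eq_zero_or_pos m with rfl | hm
      · simpa using hpos
      · exact hlt (m + 1) (by omega) le_rfl
    unfold IsRepr at hr
    rw [Finset.sum_Icc_succ_top (by omega)] at hr
    have hmod : x % c (m + 1) = ∑ j ∈ Finset.Icc 1 m, γ j * c j := by
      rw [← hr, Nat.add_mul_mod_self_right, Nat.mod_eq_of_lt hS]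
    have hdiv : x / c (m + 1) = γ (m + 1) := by
      rw [← hr, Nat.add_mul_div_right _ _ hpos, Nat.div_eq_of_lt hS, zero_add]
    have := ih (hc.mono m.le_succ) (x := ∑ j ∈ Finset.Icc 1 m, γ j * c j)
      ⟨rfl, fun i h1 h2 => hlt i h1 (by omega)⟩
    unfold reprSize at this ⊢
    rw [Finset.sum_Icc_succ_top (by omega), this, greedySize, hmod, hdiv, add_comm]

theorem exists_isGreedy {c : ℕ → ℕ} {m : ℕ} (hc : IsCoinSystem m c) (hm : 1 ≤ m) (x : ℕ) :
    ∃ γ, IsGreedy m c x γ := by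
  induction m, hm using Nat.le_induction generalizing x with
  | base => exact ⟨fun _ => x, by simp [IsRepr, hc.1], fun i _ _ => by omega⟩
  | succ m hm ih =>
    have hpos := hc.pos (i := m + 1) (by omega) le_rfl
    obtain ⟨γ, hr, hlt⟩ := ih (hc.mono m.le_succ) (x % c (m + 1))
    have key : ∀ n, n ≤ m → ∑ j ∈ Finset.Icc 1 n,
        Function.update γ (m + 1) (x / c (m + 1)) j * c j = ∑ j ∈ Finset.Icc 1 n, γ j * c j := by
      intro n hn
      refine Finset.sum_congr rfl fun j hj => ?_
      rw [Finset.mem_Icc] at hj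
      rw [Function.update_of_ne (by omega)]
    refine ⟨Function.update γ (m + 1) (x / c (m + 1)), ?_, fun i h1 h2 => ?_⟩
    · unfold IsRepr at hr ⊢
      rw [Finset.sum_Icc_succ_top (by omega), key m le_rfl, hr, Function.update_self]
      exact Nat.mod_add_div' x _
    · rw [key (i - 1) (by omega)]
      rcases h2.eq_or_lt with rfl | h
      · rw [Nat.add_sub_cancel, hr]
        exact Nat.mod_lt _ hpos
      · exact hlt i h1 (by omega)

theorem greedySize_mul_coin_le {c : ℕ → ℕ} {m : ℕ} (hc : IsCoinSystem m c)
    (hsub : IsSubadditive (greedySize c m)) {i : ℕ} (hi : 1 ≤ i) (him : i ≤ m) (n : ℕ) :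
    greedySize c m (n * c i) ≤ n := by
  induction n with
  | zero => simp [greedySize_zero]
  | succ n ih =>
    have h1 := hsub (n * c i) (c i)
    have h2 := greedySize_coin_le hc hi him
    rw [add_mul, one_mul]
    omega

theorem isCanonical_iff_isSubadditive {c : ℕ → ℕ} {m : ℕ} (hc : IsCoinSystem m c)
    (hm : 1 ≤ m) : IsCanonical m c ↔ IsSubadditive (greedySize c m) := by
  constructor
  · intro h x y
    obtain ⟨γ, hγ⟩ := exists_isGreedy hc hm (x + y)
    obtain ⟨α, hα⟩ := exists_isGreedy hc hm x
    obtain ⟨β, hβ⟩ := exists_isGreedy hc hm y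
    rw [← hγ.reprSize_eq hc, ← hα.reprSize_eq hc, ← hβ.reprSize_eq hc]
    by_contra hlt
    refine h (x + y) ⟨γ, fun i => α i + β i, hγ, ?_, ?_⟩
    · have h1 := hα.1
      have h2 := hβ.1
      unfold IsRepr at *
      simp only [add_mul, Finset.sum_add_distrib, h1, h2]
    · unfold reprSize at *
      simp only [Finset.sum_add_distrib]
      omega
  · rintro h x ⟨γ, β, hγ, hβ, hlt⟩
    rw [hγ.reprSize_eq hc] at hlt
    have : greedySize c m x ≤ reprSize m β := by
      unfold IsRepr at hβ
      rw [← hβ, reprSize]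
      refine (Finset.le_sum_of_subadditive (greedySize c m) (greedySize_zero c m).le h _ _).trans
        (Finset.sum_le_sum fun i hi => ?_)
      rw [Finset.mem_Icc] at hi
      exact greedySize_mul_coin_le hc h hi.1 hi.2 _
    omega

theorem nonCanonical_iff_not_isSubadditive {c : ℕ → ℕ} {m : ℕ} (hc : IsCoinSystem m c)
    (hm : 1 ≤ m) : NonCanonical m c ↔ ¬ IsSubadditive (greedySize c m) := by
  rw [← isCanonical_iff_isSubadditive hc hm]
  simp [NonCanonical, IsCanonical]

/-- Subadditivity of the greedy size only has to be tested on amounts below the largest coin. -/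
theorem isSubadditive_greedySize_succ {c : ℕ → ℕ} {m : ℕ} (hpos : 0 < c (m + 1))
    (h1 : ∀ r s, r + s < c (m + 1) → greedySize c m (r + s) ≤ greedySize c m r + greedySize c m s)
    (h2 : ∀ r s t, r < c (m + 1) → s < c (m + 1) → r + s = c (m + 1) + t →
      1 + greedySize c m t ≤ greedySize c m r + greedySize c m s) :
    IsSubadditive (greedySize c (m + 1)) := by
  intro x y
  have hr := Nat.mod_lt x hpos
  have hs := Nat.mod_lt y hpos
  have hx := Nat.div_add_mod' x (c (m + 1))
  have hy := Nat.div_add_mod' y (c (m + 1))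
  set r := x % c (m + 1)
  set s := y % c (m + 1)
  have hxy : x + y = (x / c (m + 1) + y / c (m + 1)) * c (m + 1) + (r + s) := by
    rw [add_mul]; omega
  have ex : greedySize c (m + 1) x = x / c (m + 1) + greedySize c m r := rfl
  have ey : greedySize c (m + 1) y = y / c (m + 1) + greedySize c m s := rfl
  rw [hxy, greedySize_succ_mul_add hpos, ex, ey]
  by_cases h : r + s < c (m + 1)
  · rw [greedySize_succ_of_lt h]
    have := h1 r s h
    omega
  · obtain ⟨t, ht⟩ := Nat.exists_eq_add_of_le (not_lt.mp h)
    have := h2 r s t hr hs ht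
    rw [ht, greedySize_succ_add hpos, greedySize_succ_of_lt (by omega)]
    omega

/-- The one-point theorem: adding a coin `c (m + 2)` to a canonical system keeps it canonical
if a single multiple of `c (m + 1)` is not a counterexample. -/
theorem isSubadditive_greedySize_of_one_point {c : ℕ → ℕ} {m k δ : ℕ} (hpos : 0 < c (m + 1))
    (hpos' : 0 < c (m + 2)) (hsub : IsSubadditive (greedySize c (m + 1)))
    (hk : k * c (m + 1) = c (m + 2) + δ) (hδ : greedySize c (m + 1) δ < k) :
    IsSubadditive (greedySize c (m + 2)) := by
  refine isSubadditive_greedySize_succ hpos' (fun r s _ => hsub r s) fun r s t _ _ h => ?_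
  have h : r + s = c (m + 2) + t := h
  have h1 := greedySize_succ_mul_add hpos k t
  rw [show k * c (m + 1) + t = r + s + δ by omega] at h1
  have h2 := hsub (r + s) δ
  have h3 := hsub r s
  omega

theorem exists_mul_eq_add {a b : ℕ} (ha : 0 < a) : ∃ k δ, k * a = b + δ ∧ δ < a := by
  have h1 := Nat.div_add_mod' (b + (a - 1)) a
  have h2 := Nat.mod_lt (b + (a - 1)) ha
  exact ⟨(b + (a - 1)) / a, a - 1 - (b + (a - 1)) % a, by omega, by omega⟩

/-- If the sum of two coins lies between `c k` and the next coin, its excess over `c k` is zero or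
a coin. -/
theorem coin_add_coin_sub {c : ℕ → ℕ} {m n : ℕ} (hc : IsCoinSystem m c)
    (hsub : IsSubadditive (greedySize c m)) {i j y : ℕ} (hi : 1 ≤ i) (him : i ≤ m) (hj : 1 ≤ j)
    (hjm : j ≤ m) (hnm : n + 1 ≤ m) (hn : c i + c j = c (n + 1) + y)
    (hlt : greedySize c m (c i + c j) = greedySize c (n + 1) (c i + c j)) :
    y = 0 ∨ ∃ k, 1 ≤ k ∧ k ≤ n + 1 ∧ y = c k := by
  refine eq_zero_or_coin_of_greedySize_le_one (hc.mono hnm) (by omega) ?_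
  have h1 := hsub (c i) (c j)
  have h2 := greedySize_coin_le hc hi him
  have h3 := greedySize_coin_le hc hj hjm
  rw [hlt, hn, greedySize_succ_add (hc.pos (by omega) hnm)] at h1
  omega

theorem isSubadditive_greedySize_two {c : ℕ → ℕ} {m : ℕ} (hc : IsCoinSystem m c) (hm : 2 ≤ m) :
    IsSubadditive (greedySize c 2) := by
  have h1 : ∀ x, greedySize c 1 x = x := fun x => by simp [greedySize, hc.1]
  have h2 := hc.pos (i := 2) (by omega) hm
  refine isSubadditive_greedySize_of_one_point (k := c 2) (δ := 0) (by rw [hc.1]; exact one_pos)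
    h2 (fun x y => by rw [h1, h1, h1]) (by simp [hc.1]) (by rw [h1]; exact h2)

/-- The excess of a sum of two coins over the largest coin of a canonical five-coin system. -/
theorem excess_top {c : ℕ → ℕ} (hc : IsCoinSystem 5 c) (hsub : IsSubadditive (greedySize c 5))
    {i j : ℕ} (hi : 1 ≤ i) (hi5 : i ≤ 5) (hj : 1 ≤ j) (hj5 : j ≤ 5) {y : ℕ}
    (h : c i + c j = c 5 + y) : y = 0 ∨ y = 1 ∨ y = c 2 ∨ y = c 3 ∨ y = c 4 ∨ y = c 5 := by
  rcases coin_add_coin_sub (n := 4) hc hsub hi hi5 hj hj5 le_rfl h rfl with h | ⟨k, h1, h2, rfl⟩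
  · exact Or.inl h
  · have := hc.1
    interval_cases k <;> simp_all

/-- The excess of a sum of two coins over the fourth coin of a canonical five-coin system, when
that sum is smaller than the fifth coin. -/
theorem excess_four {c : ℕ → ℕ} (hc : IsCoinSystem 5 c) (hsub : IsSubadditive (greedySize c 5))
    {i j : ℕ} (hi : 1 ≤ i) (hi5 : i ≤ 5) (hj : 1 ≤ j) (hj5 : j ≤ 5) {y : ℕ}
    (h : c i + c j = c 4 + y) (hlt : c i + c j < c 5) :
    y = 0 ∨ y = 1 ∨ y = c 2 ∨ y = c 3 ∨ y = c 4 := by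
  rcases coin_add_coin_sub (n := 3) hc hsub hi hi5 hj hj5 (by omega) h
    (greedySize_succ_of_lt hlt) with h | ⟨k, h1, h2, rfl⟩
  · exact Or.inl h
  · have := hc.1
    interval_cases k <;> simp_all

theorem isSubadditive_greedySize_three {c : ℕ → ℕ} (hc : IsCoinSystem 5 c)
    (hsub : IsSubadditive (greedySize c 5)) : IsSubadditive (greedySize c 3) := by
  have h1 := hc.1
  have h12 := hc.2 1 2 (by omega) (by omega) (by omega)
  have h23 := hc.2 2 3 (by omega) (by omega) (by omega)
  have h34 := hc.2 3 4 (by omega) (by omega) (by omega)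
  have h45 := hc.2 4 5 (by omega) (by omega) (by omega)
  obtain ⟨k, δ, hk, hδ⟩ := exists_mul_eq_add (b := c 3) (a := c 2) (by omega)
  have lt5 : ∀ {x}, x < c 5 → greedySize c 5 x = greedySize c 4 x := greedySize_succ_of_lt
  have lt4 : ∀ {x}, x < c 4 → greedySize c 4 x = greedySize c 3 x := greedySize_succ_of_lt
  have lt3 : ∀ {x}, x < c 3 → greedySize c 3 x = greedySize c 2 x := greedySize_succ_of_lt
  have add3 : ∀ x, greedySize c 3 (c 3 + x) = 1 + greedySize c 3 x :=
    greedySize_succ_add (hc.pos (by omega) (by omega))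
  have h2sub := isSubadditive_greedySize_two hc (by omega)
  have hgδ : greedySize c 2 δ = δ := by
    rw [greedySize_succ_of_lt hδ]; simp [greedySize, h1]
  by_contra hnot
  have hkδ : k ≤ δ := by
    by_contra! h
    exact hnot (isSubadditive_greedySize_of_one_point (hc.pos (by omega) (by omega))
      (hc.pos (by omega) (by omega)) h2sub hk (by rw [hgδ]; exact h))
  have hd : c 4 ≤ k * c 2 := by
    by_contra h
    have h2 := greedySize_mul_coin_le hc hsub (i := 2) (by omega) (by omega) k
    rw [lt5 (by omega), lt4 (by omega), hk, add3, lt3 (by omega), hgδ] at h2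
    omega
  obtain ⟨n, rfl⟩ : ∃ n, k = n + 2 := by
    match k, hk with
    | 0, hk => omega
    | 1, hk => omega
    | n + 2, _ => exact ⟨n, rfl⟩
  have hn : n = 0 ∧ n * c 2 = 0 ∨ c 2 ≤ n * c 2 := by
    rcases Nat.eq_zero_or_pos n with rfl | h
    · simp
    · exact Or.inr (Nat.le_mul_of_pos_left _ h)
  rw [add_mul] at hk hd
  by_cases hab : c 2 + c 3 < c 5
  · have e1 := excess_four hc hsub (i := 2) (j := 3) (y := c 2 + c 3 - c 4) (by omega) (by omega)
      (by omega) (by omega) (by omega) hab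
    have hd' : c 4 = c 2 + c 3 - 1 := by omega
    by_cases hbb : c 3 + c 3 < c 5
    · have e2 := excess_four hc hsub (i := 3) (j := 3) (y := c 3 + c 3 - c 4) (by omega)
        (by omega) (by omega) (by omega) (by omega) hbb
      omega
    · have e3 := excess_top hc hsub (i := 3) (j := 4) (y := c 3 + c 4 - c 5) (by omega)
        (by omega) (by omega) (by omega) (by omega)
      have he : c 5 = c 3 + c 4 - c 2 := by omega
      have e4 := excess_top hc hsub (i := 4) (j := 4) (y := c 4 + c 4 - c 5) (by omega)
        (by omega) (by omega) (by omega) (by omega)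
      omega
  · have e1 := excess_top hc hsub (i := 2) (j := 3) (y := c 2 + c 3 - c 5) (by omega)
      (by omega) (by omega) (by omega) (by omega)
    have e2 := excess_top hc hsub (i := 2) (j := 4) (y := c 2 + c 4 - c 5) (by omega)
      (by omega) (by omega) (by omega) (by omega)
    have he : c 2 + c 3 = c 5 := by omega
    have hd' : c 4 = c 3 + 1 := by omega
    have e3 := excess_top hc hsub (i := 3) (j := 3) (y := c 3 + c 3 - c 5) (by omega)
      (by omega) (by omega) (by omega) (by omega)
    have e4 := excess_top hc hsub (i := 3) (j := 4) (y := c 3 + c 4 - c 5) (by omega)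
      (by omega) (by omega) (by omega) (by omega)
    omega

/-- `⟨1, c 2, c 3, c 4⟩` is non-canonical while `⟨1, c 2, c 3, c 4, c 5⟩` is canonical
iff `c 3 > 3`, `c 2 = 2`, `c 4 = c 3 + 1` and `c 5 = 2 * c 3`. -/
theorem stmt_11 (c : ℕ → ℕ) (hc : IsCoinSystem 5 c) :
    (NonCanonical 4 c ∧ IsCanonical 5 c) ↔
      (3 < c 3 ∧ c 2 = 2 ∧ c 4 = c 3 + 1 ∧ c 5 = 2 * c 3) := by
  rw [nonCanonical_iff_not_isSubadditive (hc.mono (by omega)) (by omega),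
    isCanonical_iff_isSubadditive hc (by omega)]
  have h1 := hc.1
  have h12 := hc.2 1 2 (by omega) (by omega) (by omega)
  have h23 := hc.2 2 3 (by omega) (by omega) (by omega)
  have h34 := hc.2 3 4 (by omega) (by omega) (by omega)
  have h45 := hc.2 4 5 (by omega) (by omega) (by omega)
  have lt5 : ∀ {x}, x < c 5 → greedySize c 5 x = greedySize c 4 x := greedySize_succ_of_lt
  have lt4 : ∀ {x}, x < c 4 → greedySize c 4 x = greedySize c 3 x := greedySize_succ_of_lt
  have lt3 : ∀ {x}, x < c 3 → greedySize c 3 x = greedySize c 2 x := greedySize_succ_of_lt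
  have add4 : ∀ x, greedySize c 4 (c 4 + x) = 1 + greedySize c 4 x :=
    greedySize_succ_add (hc.pos (by omega) (by omega))
  constructor
  · rintro ⟨hnot, hsub⟩
    obtain ⟨k, δ, hk, hδ⟩ := exists_mul_eq_add (b := c 4) (a := c 3) (by omega)
    have hkδ : k ≤ greedySize c 3 δ := by
      by_contra! h
      exact hnot (isSubadditive_greedySize_of_one_point (hc.pos (by omega) (by omega))
        (hc.pos (by omega) (by omega)) (isSubadditive_greedySize_three hc hsub) hk h)
    have hd : c 5 ≤ k * c 3 := by
      by_contra h
      have h2 := greedySize_mul_coin_le hc hsub (i := 3) (by omega) (by omega) k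
      rw [lt5 (by omega), hk, add4, lt4 (by omega)] at h2
      omega
    have e1 := excess_top hc hsub (i := 3) (j := 4) (y := c 3 + c 4 - c 5) (by omega) (by omega)
      (by omega) (by omega) (by omega)
    have e2 := excess_top hc hsub (i := 4) (j := 4) (y := c 4 + c 4 - c 5) (by omega) (by omega)
      (by omega) (by omega) (by omega)
    obtain rfl : k = 2 := by
      have hk3 : k < 3 := by
        by_contra! h
        have := Nat.mul_le_mul_right (c 3) h
        omega
      interval_cases k <;> omega
    have g1 := greedySize_coin_le (hc.mono (n := 3) (by omega)) (i := 1) (by omega) (by omega)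
    have g2 := greedySize_coin_le (hc.mono (n := 3) (by omega)) (i := 2) (by omega) (by omega)
    have d1 : δ ≠ c 1 := by rintro rfl; omega
    have d2 : δ ≠ c 2 := by rintro rfl; omega
    omega
  · rintro ⟨hb, h2, h4, h5⟩
    have hg2 : ∀ x, greedySize c 2 x = x / 2 + x % 2 := fun x => by simp [greedySize, h1, h2]
    have hg3 : ∀ x, x < c 3 → greedySize c 3 x = x / 2 + x % 2 := fun x hx => by
      rw [lt3 hx, hg2]
    have hg3' : greedySize c 3 (c 3) = 1 := by
      have := greedySize_succ_add (hc.pos (i := 3) (by omega) (by omega)) 0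
      rwa [greedySize_zero] at this
    have hg4 : ∀ x, c 4 ≤ x → x < c 5 →
        greedySize c 4 x = 1 + ((x - c 4) / 2 + (x - c 4) % 2) := fun x hx hx' => by
      obtain ⟨y, rfl⟩ := Nat.exists_eq_add_of_le hx
      rw [add4, lt4 (by omega), hg3 _ (by omega), Nat.add_sub_cancel_left]
    have hg4' : ∀ x, x < c 5 → (x < c 3 ∧ greedySize c 4 x = x / 2 + x % 2) ∨
        (x = c 3 ∧ greedySize c 4 x = 1) ∨
        (c 4 ≤ x ∧ greedySize c 4 x = 1 + ((x - c 4) / 2 + (x - c 4) % 2)) := fun x hx => by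
      rcases lt_trichotomy x (c 3) with h | h | h
      · exact Or.inl ⟨h, by rw [lt4 (by omega), hg3 x h]⟩
      · exact Or.inr (Or.inl ⟨h, by rw [h, lt4 (by omega), hg3']⟩)
      · exact Or.inr (Or.inr ⟨by omega, hg4 x (by omega) hx⟩)
    constructor
    · intro h
      have h6 := h (c 3) (c 3)
      have h7 := greedySize_coin_le (hc.mono (n := 4) (by omega)) (i := 3) (by omega) (by omega)
      rw [show c 3 + c 3 = c 4 + (c 3 - 1) by omega, add4, lt4 (by omega),
        hg3 _ (by omega)] at h6
      omega
    · refine isSubadditive_greedySize_succ (hc.pos (by omega) le_rfl)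
        (fun r s (h : r + s < c 5) => ?_)
        fun r s t (hr : r < c 5) (hs : s < c 5) (h : r + s = c 5 + t) => ?_
      · have a1 := hg4' r (by omega)
        have a2 := hg4' s (by omega)
        have a3 := hg4' (r + s) h
        omega
      · have a1 := hg4' r hr
        have a2 := hg4' s hs
        have a3 := hg4' t (by omega)
        omega
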